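/- arXiv:2501.14924 — 3 statements merged into one kernel-verified Lean document; each statement's English description precedes it below -/
import Mathlib

section
/- Suppose a cyclic (m,n,k,λ)-relative difference set R exists in ZMod(m·n). Let w be a divisor of m·n that does not divide m, let t be a w-multiplier of R, and suppose t^f ≡ −1 (mod w) for some integer f. Then either k is a perfect square, or k = k₁²·q for some integer k₁ and some prime q dividing w. In the latter case: (1) if p ≠ q is a prime with p^α exactly dividing w, then p^α divides m; (2) if q is odd and q does not divide m, then q ≡ 1 (mod 4); (3) if q = 2, then 4 divides w; and (4) if q does not divide m, then t is a quadratic residue modulo q. -/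
/-- Additive version: `R` is an `(m,n,k,l)`-relative difference set in the abelian group `G`
relative to the subgroup `N` of order `n` (every subgroup of an abelian group is normal). -/
def IsAddRDS {G : Type*} [AddCommGroup G] (m n k l : ℕ) (N : AddSubgroup G) (R : Set G) : Prop :=
  Nat.card G = m * n ∧ Nat.card N = n ∧ R.ncard = k ∧
    (∀ g : G, g ∉ N → {p : G × G | p.1 ∈ R ∧ p.2 ∈ R ∧ p.1 - p.2 = g}.ncard = l) ∧
    (∀ g : G, g ∈ N → g ≠ 0 → {p : G × G | p.1 ∈ R ∧ p.2 ∈ R ∧ p.1 - p.2 = g}.ncard = 0)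

/-- `t` is a `w`-multiplier of `R ⊆ ZMod (m*n)`: `t` is coprime to `w` and multiplication by
`t` sends the multiset of reductions of `R` modulo `w` to a translate of itself. -/
def IsWMultiplier (m n w : ℕ) (hw : w ∣ m * n) (R : Finset (ZMod (m * n))) (t : ℤ) : Prop :=
  Int.gcd t w = 1 ∧ ∃ s : ZMod w,
    Multiset.map (fun x => (t : ZMod w) * x)
        (R.val.map (fun x => ZMod.castHom hw (ZMod w) x)) =
      Multiset.map (fun x => x + s)
        (R.val.map (fun x => ZMod.castHom hw (ZMod w) x))

/-- The diagonal difference is represented exactly once by each element of `R`. -/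
theorem card_filter_sub_eq_zero {G : Type*} [AddCommGroup G] [DecidableEq G] (R : Finset G) :
    ((R ×ˢ R).filter fun p => p.1 - p.2 = 0).card = R.card := by
  rw [← Finset.diag_card R]
  congr 1
  ext ⟨x, y⟩
  simp only [Finset.mem_filter, Finset.mem_product, Finset.mem_diag, sub_eq_zero]
  grind

theorem ncard_difference_representations {G : Type*} [AddCommGroup G] [DecidableEq G]
    (R : Finset G) (g : G) :
    {p : G × G | p.1 ∈ (R : Set G) ∧ p.2 ∈ (R : Set G) ∧ p.1 - p.2 = g}.ncard =
      ((R ×ˢ R).filter fun p => p.1 - p.2 = g).card := by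
  rw [← Set.ncard_coe_finset]
  congr 1
  ext p
  simp [and_assoc]

/-- A character that is nontrivial on the forbidden subgroup has square modulus `k` on an RDS. -/
theorem IsAddRDS.sum_mul_sum_neg {G : Type*} [AddCommGroup G] [Fintype G] {m n k l : ℕ}
    {N : AddSubgroup G} {R : Finset G} (hR : IsAddRDS m n k l N (R : Set G))
    (ψ : AddChar G ℂ) {g : G} (hg : g ∈ N) (hψ : ψ g ≠ 1) :
    (∑ x ∈ R, ψ x) * ∑ y ∈ R, ψ (-y) = k := by
  classical
  obtain ⟨-, -, hk, hout, hin⟩ := hR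
  rw [Set.ncard_coe_finset] at hk
  have hcount (a : G) : (((R ×ˢ R).filter fun p => p.1 - p.2 = a).card : ℂ) =
      (if a = 0 then (k : ℂ) else 0) + (l - if a ∈ N then (l : ℂ) else 0) := by
    by_cases ha : a = 0
    · subst ha
      simp only [↓reduceIte, N.zero_mem, sub_self, add_zero]
      rw [← hk, ← card_filter_sub_eq_zero R]
    · by_cases haN : a ∈ N
      · have := hin a haN ha
        rw [ncard_difference_representations] at this
        simp [this, ha, haN]
      · have := hout a haN
        rw [ncard_difference_representations] at this
        simp [this, ha, haN]
  have hall : ∑ a : G, ψ a = 0 := by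
    rw [AddChar.sum_eq_zero_iff_ne_zero]
    rintro rfl
    exact hψ (by simp)
  have hN : ∑ a : G, (if a ∈ N then ψ a else 0) = 0 := by
    have hshift : ∑ a : G, (if a ∈ N then ψ a else 0) =
        ψ g * ∑ a : G, (if a ∈ N then ψ a else 0) := by
      rw [Finset.mul_sum, ← Equiv.sum_comp (Equiv.addLeft g)]
      refine Finset.sum_congr rfl fun a _ => ?_
      simp only [Equiv.coe_addLeft, N.add_mem_cancel_left hg, AddChar.map_add_eq_mul]
      split_ifs <;> simp
    have : (1 - ψ g) * ∑ a : G, (if a ∈ N then ψ a else 0) = 0 := by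
      linear_combination hshift
    exact (mul_eq_zero.mp this).resolve_left (sub_ne_zero.mpr (Ne.symm hψ))
  calc (∑ x ∈ R, ψ x) * ∑ y ∈ R, ψ (-y)
      = ∑ p ∈ R ×ˢ R, ψ (p.1 - p.2) := by
        rw [Finset.sum_mul_sum, Finset.sum_product]
        simp only [sub_eq_add_neg, AddChar.map_add_eq_mul]
    _ = ∑ a : G, ∑ p ∈ (R ×ˢ R).filter (fun p => p.1 - p.2 = a), ψ (p.1 - p.2) :=
        (Finset.sum_fiberwise_of_maps_to (fun _ _ => Finset.mem_univ _) _).symm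
    _ = ∑ a : G, (((R ×ˢ R).filter fun p => p.1 - p.2 = a).card : ℂ) * ψ a := by
        refine Finset.sum_congr rfl fun a _ => ?_
        rw [Finset.sum_congr rfl fun p hp => by rw [(Finset.mem_filter.mp hp).2],
          Finset.sum_const, nsmul_eq_mul]
    _ = ∑ a : G, ((if a = 0 then (k : ℂ) * ψ a else 0) +
          (l * ψ a - l * if a ∈ N then ψ a else 0)) := by
        refine Finset.sum_congr rfl fun a _ => ?_
        rw [hcount]
        split_ifs <;> ring
    _ = k := by
        rw [Finset.sum_add_distrib, Finset.sum_sub_distrib, ← Finset.mul_sum, ← Finset.mul_sum,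
          hall, hN]
        simp

/-- A finite subset of `ℤ` that is a relative difference set relative to a nontrivial subgroup
has at most one element. -/
theorem IsAddRDS.card_le_one_of_int {m n k l : ℕ} {R : Finset ℤ}
    (hR : IsAddRDS m n k l (AddSubgroup.zmultiples (m : ℤ)) (R : Set ℤ)) (hm : m ≠ 0) :
    k ≤ 1 := by
  classical
  obtain ⟨-, -, hk, hout, hin⟩ := hR
  rw [Set.ncard_coe_finset] at hk
  rw [← hk, Finset.card_le_one]
  intro a ha b hb
  by_contra hab
  set N : AddSubgroup ℤ := AddSubgroup.zmultiples (m : ℤ)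
  have hrep (x : ℤ) (c d : ℤ) (hc : c ∈ R) (hd : d ∈ R) (hx : c - d = x) :
      ((R ×ˢ R).filter fun p => p.1 - p.2 = x).card ≠ 0 := by
    rw [Finset.card_ne_zero]
    exact ⟨(c, d), by simp [hc, hd, hx]⟩
  have hout' (x : ℤ) (hx : ¬ (m : ℤ) ∣ x) :
      ((R ×ˢ R).filter fun p => p.1 - p.2 = x).card = l := by
    rw [← ncard_difference_representations]
    exact hout x (fun h => hx (Int.mem_zmultiples_iff.mp h))
  have hin' (x : ℤ) (hx : (m : ℤ) ∣ x) (hx0 : x ≠ 0) :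
      ((R ×ˢ R).filter fun p => p.1 - p.2 = x).card = 0 := by
    rw [← ncard_difference_representations]
    exact hin x (Int.mem_zmultiples_iff.mpr hx) hx0
  have hab' : ¬ (m : ℤ) ∣ a - b := fun h =>
    hrep (a - b) a b ha hb rfl (hin' _ h (sub_ne_zero.mpr hab))
  have hl : l ≠ 0 := by
    rw [← hout' _ hab']
    exact hrep _ a b ha hb rfl
  -- differences outside `N` are unbounded, but only finitely many are represented
  have hsub (j : ℕ) : (a - b) + m * (j : ℤ) ∈ (R ×ˢ R).image (fun p => p.1 - p.2) := by
    have hnd : ¬ (m : ℤ) ∣ (a - b) + m * (j : ℤ) := fun h =>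
      hab' ((dvd_add_left (dvd_mul_right _ _)).mp h)
    have := hout' _ hnd
    obtain ⟨p, hp⟩ := Finset.card_ne_zero.mp (this.trans_ne hl)
    rw [Finset.mem_filter] at hp
    exact Finset.mem_image.mpr ⟨p, hp.1, hp.2⟩
  have hinj : Function.Injective fun j : ℕ => (a - b) + m * (j : ℤ) := by
    intro i j hij
    simpa [hm] using hij
  exact Set.infinite_of_injective_forall_mem hinj hsub (Finset.finite_toSet _)

theorem IsAddRDS.card_le_one_of_mul_eq_zero {m n k l : ℕ} {R : Finset (ZMod (m * n))}
    (hR : IsAddRDS m n k l (AddSubgroup.zmultiples ((m : ZMod (m * n))))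
      (R : Set (ZMod (m * n)))) (hm : m ≠ 0) (h0 : m * n = 0) : k ≤ 1 := by
  obtain rfl : n = 0 := (mul_eq_zero.mp h0).resolve_left hm
  exact IsAddRDS.card_le_one_of_int (n := 0) (l := l) (R := R) hR hm

/-- If multiplication by `t` translates `M`, so does multiplication by any power of `t`. -/
theorem exists_map_pow_mul_eq_map_add {w : ℕ} {M : Multiset (ZMod w)} {t s : ZMod w}
    (h : M.map (fun x => t * x) = M.map (fun x => x + s)) (i : ℕ) :
    ∃ s', M.map (fun x => t ^ i * x) = M.map (fun x => x + s') := by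
  induction i with
  | zero => exact ⟨0, by simp⟩
  | succ i ih =>
    obtain ⟨s', hs'⟩ := ih
    refine ⟨s + t * s', ?_⟩
    have h1 := congrArg (Multiset.map fun x => t * x) hs'
    have h2 := congrArg (Multiset.map fun x => x + t * s') h
    simp only [Multiset.map_map, Function.comp_def] at h1 h2
    calc M.map (fun x => t ^ (i + 1) * x) = M.map (fun x => t * (t ^ i * x)) := by
          congr 1; ext x; ring
      _ = M.map (fun x => t * x + t * s') := by rw [h1]; congr 1; ext x; ring
      _ = M.map (fun x => x + (s + t * s')) := by rw [h2]; congr 1; ext x; ring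

/-- The character sum `∑ e(a x)` over a multiset `M` of residues modulo `w`. -/
noncomputable def charSum {w : ℕ} [NeZero w] (M : Multiset (ZMod w)) (a : ZMod w) : ℂ :=
  (M.map fun x => ZMod.stdAddChar (a * x)).sum

section charSum

variable {w : ℕ} [NeZero w] (M : Multiset (ZMod w))

theorem charSum_map_mul (t a : ZMod w) : charSum (M.map fun x => t * x) a = charSum M (a * t) := by
  simp [charSum, mul_assoc]

theorem charSum_map_add (s a : ZMod w) :
    charSum (M.map fun x => x + s) a = ZMod.stdAddChar (a * s) * charSum M a := by
  simp only [charSum, Multiset.map_map, Function.comp_def, mul_add, AddChar.map_add_eq_mul,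
    Multiset.sum_map_mul_right]
  rw [mul_comm]

theorem charSum_zero : charSum M 0 = M.card := by
  simp [charSum]

theorem sum_charSum : ∑ a, charSum M a = (w * M.count 0 : ℕ) := by
  classical
  induction M using Multiset.induction_on with
  | empty => simp [charSum]
  | cons x M ih =>
    have hx : ∑ a : ZMod w, ZMod.stdAddChar (a * x) = ((if x = 0 then w else 0 : ℕ) : ℂ) := by
      rw [AddChar.sum_mulShift x (ZMod.isPrimitive_stdAddChar w), ZMod.card]
    have hs (a : ZMod w) :
        charSum (x ::ₘ M) a = ZMod.stdAddChar (a * x) + charSum M a := by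
      simp [charSum]
    simp only [hs, Finset.sum_add_distrib, ih, hx]
    by_cases h : x = 0
    · subst h; simp; ring
    · simp [h, Multiset.count_cons_of_ne (Ne.symm h)]

theorem stdAddChar_eq_pow (y : ZMod w) :
    ZMod.stdAddChar y = (ZMod.stdAddChar (1 : ZMod w) : ℂ) ^ y.val := by
  rw [← AddChar.map_nsmul_eq_pow]; simp

theorem stdAddChar_mul_eq_pow (h y : ZMod w) :
    ZMod.stdAddChar (h * y) = (ZMod.stdAddChar h : ℂ) ^ y.val := by
  rw [← AddChar.map_nsmul_eq_pow]; simp [mul_comm]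

theorem isPrimitiveRoot_stdAddChar_one :
    IsPrimitiveRoot (ZMod.stdAddChar (1 : ZMod w) : ℂ) w where
  pow_eq_one := by
    rw [← AddChar.map_nsmul_eq_pow]; simp
  dvd_of_pow_eq_one l hl := by
    rw [← AddChar.map_nsmul_eq_pow, ← AddChar.map_zero_eq_one (ZMod.stdAddChar (N := w))] at hl
    have := ZMod.injective_stdAddChar hl
    rw [nsmul_one] at this
    exact (ZMod.natCast_eq_zero_iff l w).mp this

/-- Galois conjugation: an integral linear relation between two character sums is preserved
when the characters are multiplied by a unit. -/
theorem charSum_mul_of_eq_int_mul {M : Multiset (ZMod w)} {g : ZMod w} {ε : ℤ}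
    (h : charSum M g = ε * charSum M 1) (b : ℕ) (hb : b.Coprime w) :
    charSum M (b * g) = ε * charSum M b := by
  let P (g : ZMod w) : Polynomial ℤ := (M.map fun x => Polynomial.X ^ (g * x).val).sum
  have hP (g c : ZMod w) : Polynomial.aeval (ZMod.stdAddChar c : ℂ) (P g) = charSum M (c * g) := by
    simp only [P, charSum, map_multiset_sum, Multiset.map_map, Function.comp_def, map_pow,
      Polynomial.aeval_X, ← stdAddChar_mul_eq_pow, mul_assoc]
  have hF (c : ZMod w) : Polynomial.aeval (ZMod.stdAddChar c : ℂ) (P g - Polynomial.C ε * P 1) =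
      charSum M (c * g) - ε * charSum M c := by
    simp [hP]
  have hζ := isPrimitiveRoot_stdAddChar_one (w := w)
  have hint := hζ.isIntegral (NeZero.pos w)
  have hdvd : minpoly ℤ (ZMod.stdAddChar (1 : ZMod w) : ℂ) ∣ P g - Polynomial.C ε * P 1 :=
    minpoly.isIntegrallyClosed_dvd hint (by rw [hF, one_mul, h, sub_self])
  rw [hζ.minpoly_eq_pow_coprime hb, ← AddChar.map_nsmul_eq_pow, nsmul_one] at hdvd
  obtain ⟨Q, hQ⟩ := hdvd
  have := hF b
  rw [hQ, map_mul, minpoly.aeval, zero_mul] at this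
  exact (sub_eq_zero.mp this.symm)

end charSum

section cyclotomic

variable {w : ℕ} [NeZero w]

/-- The ring `ℤ[ζ_w]` of complex numbers generated by the values of the standard character. -/
noncomputable abbrev cyclotomicSubring (w : ℕ) [NeZero w] : Subring ℂ :=
  Subring.closure (Set.range (ZMod.stdAddChar (N := w)))

theorem stdAddChar_mem_cyclotomicSubring (x : ZMod w) :
    (ZMod.stdAddChar x : ℂ) ∈ cyclotomicSubring w :=
  Subring.subset_closure ⟨x, rfl⟩

theorem charSum_mem_cyclotomicSubring (M : Multiset (ZMod w)) (a : ZMod w) :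
    charSum M a ∈ cyclotomicSubring w := by
  refine Subring.multiset_sum_mem _ _ fun y hy => ?_
  obtain ⟨x, -, rfl⟩ := Multiset.mem_map.mp hy
  exact stdAddChar_mem_cyclotomicSubring _

theorem isIntegral_of_mem_cyclotomicSubring {a : ℂ} (ha : a ∈ cyclotomicSubring w) :
    IsIntegral ℤ a := by
  have : cyclotomicSubring w ≤ (integralClosure ℤ ℂ).toSubring := by
    rw [Subring.closure_le]
    rintro _ ⟨x, rfl⟩
    rw [stdAddChar_eq_pow]
    exact (isPrimitiveRoot_stdAddChar_one.isIntegral (NeZero.pos w)).pow _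
  exact this ha

/-- The Frobenius of a prime `r` not dividing `w` has finite order on `ℤ[ζ_w] / r`. -/
theorem exists_pow_eq_add_mul_of_mem_cyclotomicSubring {r j : ℕ} (hr : r.Prime)
    (hj : ((r ^ j : ℕ) : ZMod w) = 1) {a : ℂ} (ha : a ∈ cyclotomicSubring w) :
    ∃ c ∈ cyclotomicSubring w, a ^ r ^ j = a + r * c := by
  have hadd {x y : ℂ} (hx : x ∈ cyclotomicSubring w) (hy : y ∈ cyclotomicSubring w) :
      ∃ c ∈ cyclotomicSubring w, (x + y) ^ r ^ j = x ^ r ^ j + y ^ r ^ j + r * c := by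
    obtain ⟨c, hc⟩ := exists_add_pow_prime_pow_eq hr
      (⟨x, hx⟩ : cyclotomicSubring w) ⟨y, hy⟩ j
    refine ⟨x * y * c, mul_mem (mul_mem hx hy) c.2, ?_⟩
    have := congrArg (Subring.subtype _) hc
    simp only [map_add, map_mul, map_pow, map_natCast, Subring.subtype_apply] at this
    rw [this]; ring
  have h0 : r ^ j ≠ 0 := pow_ne_zero _ hr.ne_zero
  induction ha using Subring.closure_induction with
  | mem x hx =>
    obtain ⟨y, rfl⟩ := hx
    refine ⟨0, zero_mem _, ?_⟩
    rw [← AddChar.map_nsmul_eq_pow, nsmul_eq_mul, hj]; simp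
  | zero => exact ⟨0, zero_mem _, by rw [zero_pow h0]; simp⟩
  | one => exact ⟨0, zero_mem _, by simp⟩
  | add x y hx hy ihx ihy =>
    obtain ⟨c, hc, hxy⟩ := hadd hx hy
    obtain ⟨cx, hcx, hx'⟩ := ihx
    obtain ⟨cy, hcy, hy'⟩ := ihy
    exact ⟨cx + cy + c, add_mem (add_mem hcx hcy) hc, by rw [hxy, hx', hy']; ring⟩
  | neg x hx ihx =>
    obtain ⟨c, hc, hxy⟩ := hadd hx (neg_mem hx)
    obtain ⟨cx, hcx, hx'⟩ := ihx
    refine ⟨-cx - c, sub_mem (neg_mem hcx) hc, ?_⟩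
    rw [add_neg_cancel, zero_pow h0] at hxy
    linear_combination -hxy - hx'
  | mul x y hx hy ihx ihy =>
    obtain ⟨cx, hcx, hx'⟩ := ihx
    obtain ⟨cy, hcy, hy'⟩ := ihy
    refine ⟨cx * y + x * cy + r * (cx * cy), ?_, by rw [mul_pow, hx', hy']; ring⟩
    exact add_mem (add_mem (mul_mem hcx hy) (mul_mem hx hcy))
      (mul_mem (natCast_mem _ _) (mul_mem hcx hcy))

/-- If `k` times a root of unity is a square in `ℤ[ζ_w]` and the prime `r` divides `k` but not
`w`, then `r ^ 2 ∣ k`, and the square root is divisible by `r`. -/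
theorem exists_eq_mul_of_sq_eq_mul_stdAddChar {r k : ℕ} (hr : r.Prime) (hrw : r.Coprime w)
    (hrk : r ∣ k) {a : ℂ} (ha : a ∈ cyclotomicSubring w) {s : ZMod w}
    (h : a ^ 2 = k * ZMod.stdAddChar s) :
    ∃ k', k = r ^ 2 * k' ∧ ∃ b ∈ cyclotomicSubring w, b ^ 2 = k' * ZMod.stdAddChar s := by
  obtain ⟨d, rfl⟩ := hrk
  have hr0 : (r : ℂ) ≠ 0 := by exact_mod_cast hr.ne_zero
  have hφ : 0 < w.totient := Nat.totient_pos.mpr (NeZero.pos w)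
  have hj : ((r ^ w.totient : ℕ) : ZMod w) = 1 := by
    have := (ZMod.natCast_eq_natCast_iff _ _ w).mpr (Nat.ModEq.pow_totient hrw)
    simpa using this
  obtain ⟨c, hc, hac⟩ := exists_pow_eq_add_mul_of_mem_cyclotomicSubring hr hj ha
  have h2 : 2 ≤ r ^ w.totient := hr.two_le.trans (Nat.le_self_pow hφ.ne' r)
  obtain ⟨e, he⟩ := Nat.exists_eq_add_of_le h2
  have hs := stdAddChar_mem_cyclotomicSubring s
  set b : ℂ := d * ZMod.stdAddChar s * a ^ e - c with hb
  have hbmem : b ∈ cyclotomicSubring w :=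
    sub_mem (mul_mem (mul_mem (natCast_mem _ _) hs) (pow_mem ha _)) hc
  have hab : a = r * b := by
    rw [he, pow_add, h] at hac
    push_cast at hac
    rw [hb]
    linear_combination -hac
  have hrb : r * b ^ 2 = d * ZMod.stdAddChar s := by
    apply mul_left_cancel₀ hr0
    rw [hab] at h
    push_cast at h
    linear_combination h
  have hneg : (ZMod.stdAddChar s : ℂ) * ZMod.stdAddChar (-s) = 1 := by
    rw [← AddChar.map_add_eq_mul]; simp
  have hint : IsIntegral ℤ (b ^ 2 * ZMod.stdAddChar (-s)) :=
    isIntegral_of_mem_cyclotomicSubring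
      (mul_mem (pow_mem hbmem _) (stdAddChar_mem_cyclotomicSubring _))
  have hd : r * (b ^ 2 * ZMod.stdAddChar (-s)) = (d : ℂ) := by
    linear_combination ZMod.stdAddChar (-s) * hrb + (d : ℂ) * hneg
  have hq : b ^ 2 * ZMod.stdAddChar (-s) = algebraMap ℚ ℂ (d / r) := by
    have : (algebraMap ℚ ℂ) (d / r) = (d : ℂ) / r := by simp
    rw [this, eq_div_iff hr0, mul_comm, hd]
  rw [hq, isIntegral_algebraMap_iff (algebraMap ℚ ℂ).injective,
    IsIntegrallyClosed.isIntegral_iff] at hint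
  obtain ⟨z, hz⟩ := hint
  have hrd : (d : ℤ) = r * z := by
    have hr0' : (r : ℚ) ≠ 0 := by exact_mod_cast hr.ne_zero
    have : (z : ℚ) = d / r := by simpa using hz
    rw [eq_div_iff hr0'] at this
    have : (z : ℤ) * r = d := by exact_mod_cast this
    linarith
  obtain ⟨d', rfl⟩ : r ∣ d := Int.natCast_dvd_natCast.mp ⟨z, hrd⟩
  refine ⟨d', by ring, b, hbmem, mul_left_cancel₀ hr0 ?_⟩
  push_cast at hrb
  linear_combination hrb

/-- If `w` is a power of the prime `p` and `k` times a root of unity is a square in `ℤ[ζ_w]`,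
then `k` is a square or `p` times a square. -/
theorem eq_sq_or_eq_sq_mul_prime {p : ℕ} (hw : ∀ r : ℕ, r.Prime → r ≠ p → r.Coprime w)
    {s : ZMod w} (k : ℕ) {a : ℂ}
    (ha : a ∈ cyclotomicSubring w) (h : a ^ 2 = k * ZMod.stdAddChar s) :
    (∃ x, k = x ^ 2) ∨ ∃ x, k = x ^ 2 * p := by
  induction k using Nat.strong_induction_on generalizing a with
  | _ k ih =>
    by_cases hk : k = 0
    · exact Or.inl ⟨0, by simp [hk]⟩
    by_cases hex : ∃ r : ℕ, r.Prime ∧ r ∣ k ∧ r ≠ p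
    · obtain ⟨r, hr, hrk, hrp⟩ := hex
      obtain ⟨k', rfl, b, hb, hbk⟩ :=
        exists_eq_mul_of_sq_eq_mul_stdAddChar hr (hw r hr hrp) hrk ha h
      have hlt : k' < r ^ 2 * k' :=
        lt_mul_of_one_lt_left (Nat.pos_of_ne_zero (right_ne_zero_of_mul hk))
          (Nat.one_lt_pow two_ne_zero hr.one_lt)
      rcases ih k' hlt hb hbk with ⟨x, rfl⟩ | ⟨x, rfl⟩
      · exact Or.inl ⟨r * x, by ring⟩
      · exact Or.inr ⟨r * x, by ring⟩
    · push Not at hex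
      have hpow := Nat.eq_prime_pow_of_unique_prime_dvd hk fun {d} hd hdk => hex d hd hdk
      rcases Nat.even_or_odd' k.primeFactorsList.length with ⟨c, hc | hc⟩
      · exact Or.inl ⟨p ^ c, by rw [hpow, hc]; ring⟩
      · exact Or.inr ⟨p ^ c, by rw [hpow, hc]; ring⟩

end cyclotomic

/-- The multiset of reductions modulo `w` of the elements of `R`. -/
def reductions {N w : ℕ} (hw : w ∣ N) (R : Finset (ZMod N)) : Multiset (ZMod w) :=
  R.val.map fun x => ZMod.castHom hw (ZMod w) x

theorem map_reductions {N w v : ℕ} (hw : w ∣ N) (hv : v ∣ w) (R : Finset (ZMod N)) :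
    (reductions hw R).map (ZMod.castHom hv (ZMod v)) = reductions (hv.trans hw) R := by
  simp only [reductions, Multiset.map_map]
  congr 1
  ext x
  exact RingHom.congr_fun (Subsingleton.elim ((ZMod.castHom hv (ZMod v)).comp
    (ZMod.castHom hw (ZMod w))) (ZMod.castHom (hv.trans hw) (ZMod v))) x

theorem charSum_reductions {N w : ℕ} [NeZero w] (hw : w ∣ N) (R : Finset (ZMod N)) (a : ZMod w) :
    charSum (reductions hw R) a =
      ∑ x ∈ R, (ZMod.stdAddChar (a * ZMod.castHom hw (ZMod w) x) : ℂ) := by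
  simp only [charSum, reductions, Multiset.map_map, Function.comp_def]
  rfl

theorem IsAddRDS.charSum_mul_charSum_neg {m n k l w : ℕ} [NeZero w] [NeZero (m * n)]
    {R : Finset (ZMod (m * n))}
    (hR : IsAddRDS m n k l (AddSubgroup.zmultiples ((m : ZMod (m * n))))
      (R : Set (ZMod (m * n)))) (hw : w ∣ m * n) {a : ZMod w} (ha : a * m ≠ 0) :
    charSum (reductions hw R) a * charSum (reductions hw R) (-a) = k := by
  let ψ : AddChar (ZMod (m * n)) ℂ := (AddChar.mulShift ZMod.stdAddChar a).compAddMonoidHom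
    (ZMod.castHom hw (ZMod w)).toAddMonoidHom
  have hψ (x : ZMod (m * n)) : ψ x = ZMod.stdAddChar (a * ZMod.castHom hw (ZMod w) x) := rfl
  have hψm : ψ m ≠ 1 := by
    rw [hψ, map_natCast, ← AddChar.map_zero_eq_one (ZMod.stdAddChar (N := w))]
    exact fun h => ha (ZMod.injective_stdAddChar h)
  have := hR.sum_mul_sum_neg ψ (AddSubgroup.mem_zmultiples _) hψm
  simp only [hψ, map_neg, mul_neg] at this
  simpa only [charSum_reductions, neg_mul] using this

theorem exists_map_neg_eq_map_add {w : ℕ} {M : Multiset (ZMod w)} {t s : ZMod w} {f : ℕ}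
    (h : M.map (fun x => t * x) = M.map (fun x => x + s)) (hf : t ^ f = -1) :
    ∃ s', M.map (fun x => -x) = M.map (fun x => x + s') := by
  obtain ⟨s', hs'⟩ := exists_map_pow_mul_eq_map_add h f
  simp only [hf, neg_one_mul] at hs'
  exact ⟨s', hs'⟩

theorem charSum_neg_eq {w : ℕ} [NeZero w] {M : Multiset (ZMod w)} {s : ZMod w}
    (h : M.map (fun x => -x) = M.map (fun x => x + s)) (a : ZMod w) :
    charSum M (-a) = ZMod.stdAddChar (a * s) * charSum M a := by
  rw [← charSum_map_add, ← h]
  simp [charSum]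

section prime

variable {q : ℕ} [Fact q.Prime] {M : Multiset (ZMod q)} {k : ℕ}

theorem charSum_mul_of_eq_int_mul_of_ne_zero {g h : ZMod q} {ε : ℤ}
    (hg : charSum M g = ε * charSum M 1) (hh : h ≠ 0) :
    charSum M (h * g) = ε * charSum M h := by
  have hcop : h.val.Coprime q := by
    refine Nat.Coprime.symm ((Nat.Prime.coprime_iff_not_dvd Fact.out).mpr fun hd => hh ?_)
    rwa [← ZMod.natCast_eq_zero_iff, ZMod.natCast_zmod_val] at hd
  have := charSum_mul_of_eq_int_mul hg h.val hcop
  rwa [ZMod.natCast_zmod_val] at this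

/-- If all nontrivial character sums coincide, their common value is rational. -/
theorem exists_eq_sq_of_charSum_eq (hM : ∀ b : ZMod q, b ≠ 0 → charSum M b = charSum M 1)
    (hk : charSum M 1 ^ 2 = k) : ∃ x, k = x ^ 2 := by
  classical
  have hq : 1 < q := Nat.Prime.one_lt Fact.out
  have hsum := sum_charSum M
  rw [Fintype.sum_eq_add_sum_compl 0, charSum_zero,
    Finset.sum_congr rfl (fun b hb => hM b (by simpa using hb)), Finset.sum_const,
    Finset.card_compl, Finset.card_singleton, ZMod.card, nsmul_eq_mul] at hsum
  set z : ℤ := q * M.count 0 - M.card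
  have hz : ((q - 1 : ℕ) : ℂ) * charSum M 1 = z := by
    simp only [z]
    push_cast at hsum ⊢
    linear_combination hsum
  have hzk : ((q - 1 : ℕ) : ℤ) ^ 2 * k = z ^ 2 := by
    have : (((q - 1 : ℕ) : ℂ)) ^ 2 * k = (z : ℂ) ^ 2 := by rw [← hz, ← hk]; ring
    exact_mod_cast this
  obtain ⟨y, hy⟩ := (Int.pow_dvd_pow_iff two_ne_zero).mp (Dvd.intro _ hzk)
  refine ⟨y.natAbs, ?_⟩
  have hq0 : ((q - 1 : ℕ) : ℤ) ^ 2 ≠ 0 := by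
    have : q - 1 ≠ 0 := by omega
    positivity
  zify
  rw [sq_abs]
  apply mul_left_cancel₀ hq0
  rw [hzk, hy]; ring

/-- A multiplier modulo an odd prime `q`, some power of which is `-1`, is a quadratic residue
unless `k` is a square. -/
theorem isSquare_of_multiplier (hq : q ≠ 2) {t s s' : ZMod q} (ht0 : t ≠ 0)
    (ht : M.map (fun x => t * x) = M.map (fun x => x + s))
    (hneg : M.map (fun x => -x) = M.map (fun x => x + s'))
    (hk : ∀ g : ZMod q, g ≠ 0 → charSum M g * charSum M (-g) = k)
    (hsq : ¬ ∃ x, k = x ^ 2) : IsSquare t := by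
  have h2 : (2 : ZMod q) ≠ 0 := by
    intro h
    have := (ZMod.natCast_eq_zero_iff 2 q).mp (by exact_mod_cast h)
    exact hq ((Nat.prime_dvd_prime_iff_eq Fact.out Nat.prime_two).mp this)
  have hk0 : (k : ℂ) ≠ 0 := by
    intro h
    exact hsq ⟨0, by simpa using h⟩
  -- translate `M` so that it becomes symmetric
  set c := s' / 2
  have hc : s' = 2 * c := by simp only [c]; field_simp
  set M' := M.map fun x => x + c with hM'
  have hsqM (g : ZMod q) (hg : g ≠ 0) : charSum M' g ^ 2 = k := by
    rw [← hk g hg, charSum_neg_eq hneg, charSum_map_add, hc, mul_left_comm, two_mul,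
      mul_add, AddChar.map_add_eq_mul]
    ring
  have hsgn (g h : ZMod q) (hg : g ≠ 0) (hh : h ≠ 0) :
      ∃ ε : ℤ, ε ^ 2 = 1 ∧ charSum M' g = ε * charSum M' h := by
    rcases sq_eq_sq_iff_eq_or_eq_neg.mp ((hsqM g hg).trans (hsqM h hh).symm) with e | e
    · exact ⟨1, by norm_num, by simpa using e⟩
    · exact ⟨-1, by norm_num, by simpa using e⟩
  have hne : charSum M' 1 ≠ 0 := by
    intro h
    have := hsqM 1 one_ne_zero
    rw [h] at this
    exact hk0 (by rw [← this]; ring)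
  have ht1 : charSum M' t = charSum M' 1 := by
    have htM : M'.map (fun x => t * x) = M'.map fun x => x + (s + t * c - c) := by
      have := congrArg (Multiset.map fun x => x + t * c) ht
      simp only [hM', Multiset.map_map, Function.comp_def, mul_add] at this ⊢
      rw [this]
      congr 1; ext x; ring
    have h1 : charSum M' t = ZMod.stdAddChar (s + t * c - c) * charSum M' 1 := by
      have := charSum_map_mul M' t 1
      rwa [htM, charSum_map_add, one_mul, one_mul, eq_comm] at this
    have h3 : (ZMod.stdAddChar (2 * (s + t * c - c)) : ℂ) = 1 := by
      have e := (hsqM t ht0).trans (hsqM 1 one_ne_zero).symm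
      rw [h1, mul_pow] at e
      rw [two_mul, AddChar.map_add_eq_mul, ← sq]
      exact mul_right_cancel₀ (pow_ne_zero 2 hne) (e.trans (one_mul _).symm)
    rw [← AddChar.map_zero_eq_one (ZMod.stdAddChar (N := q))] at h3
    have h4 := (mul_eq_zero.mp (ZMod.injective_stdAddChar h3)).resolve_left h2
    rw [h1, h4, AddChar.map_zero_eq_one, one_mul]
  have hsquare (v : ZMod q) (hv : v ≠ 0) : charSum M' (v * v) = charSum M' 1 := by
    obtain ⟨ε, hε, e⟩ := hsgn v 1 hv one_ne_zero
    have hε' : (ε : ℂ) ^ 2 = 1 := by exact_mod_cast hε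
    rw [charSum_mul_of_eq_int_mul_of_ne_zero e hv, e, ← mul_assoc, ← sq, hε', one_mul]
  by_contra hts
  refine hsq (exists_eq_sq_of_charSum_eq (M := M') (fun b hb => ?_) (hsqM 1 one_ne_zero))
  by_cases hbs : IsSquare b
  · obtain ⟨v, rfl⟩ := hbs
    exact hsquare v (left_ne_zero_of_mul hb)
  · have hbt : IsSquare (b * t⁻¹) := by
      rw [← quadraticChar_neg_one_iff_not_isSquare] at hts hbs
      have hti : quadraticChar (ZMod q) t⁻¹ = -1 := by
        rw [quadraticChar_neg_one_iff_not_isSquare, isSquare_inv,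
          ← quadraticChar_neg_one_iff_not_isSquare]
        exact hts
      rw [← quadraticChar_one_iff_isSquare (mul_ne_zero hb (inv_ne_zero ht0)), map_mul, hbs, hti]
      norm_num
    obtain ⟨v, hv⟩ := hbt
    have hbv : b = t * (v * v) := by rw [← hv]; field_simp
    have hv0 : v ≠ 0 := by
      rintro rfl
      exact hb (by simp [hbv])
    have hvv : charSum M' (v * v) = (1 : ℤ) * charSum M' 1 := by simpa using hsquare v hv0
    rw [hbv, charSum_mul_of_eq_int_mul_of_ne_zero hvv ht0, ht1]
    simp

end prime

/-- Distinct primes `p`, `q` cannot both give the squarefree part of the same nonzero number. -/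
theorem Nat.Prime.eq_of_sq_mul_eq_sq_mul {p q x y : ℕ} (hp : p.Prime) (hq : q.Prime)
    (hx : x ≠ 0) (h : x ^ 2 * p = y ^ 2 * q) : p = q := by
  have hy : y ≠ 0 := by
    rintro rfl
    simp [hx, hp.ne_zero] at h
  by_contra hpq
  have := congrArg (fun a => a.factorization p) h
  simp only [Nat.factorization_mul (pow_ne_zero 2 hx) hp.ne_zero,
    Nat.factorization_mul (pow_ne_zero 2 hy) hq.ne_zero, Nat.factorization_pow,
    Finsupp.add_apply, Finsupp.smul_apply, hp.factorization, hq.factorization,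
    Finsupp.single_eq_same, Finsupp.single_eq_of_ne hpq, smul_eq_mul] at this
  omega

/-- Lam's Theorem 3.4: if a cyclic `(m,n,k,l)`-RDS has a `w`-multiplier `t` with
`t^f ≡ -1 (mod w)`, then `k` is a square or `k = k₁² q` for a prime `q ∣ w`, and in the
latter case the listed arithmetic conditions hold. -/
theorem lam_3_4 (m n k l w : ℕ) (R : Finset (ZMod (m * n)))
    (hR : IsAddRDS m n k l (AddSubgroup.zmultiples ((m : ZMod (m * n))))
      (R : Set (ZMod (m * n))))
    (hw : w ∣ m * n) (hwm : ¬ w ∣ m) (t : ℤ)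
    (ht : IsWMultiplier m n w hw R t)
    (hf : ∃ f : ℕ, t ^ f ≡ -1 [ZMOD (w : ℤ)]) :
    (∃ x : ℕ, k = x ^ 2) ∨
      ∃ k₁ q : ℕ, q.Prime ∧ q ∣ w ∧ k = k₁ ^ 2 * q ∧
        (∀ p α : ℕ, p.Prime → p ≠ q → p ^ α ∣ w → ¬ p ^ (α + 1) ∣ w → p ^ α ∣ m) ∧
        (Odd q → ¬ q ∣ m → q % 4 = 1) ∧
        (q = 2 → 4 ∣ w) ∧
        (¬ q ∣ m → IsSquare ((t : ZMod q))) := by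
  by_cases h0 : m * n = 0
  · have hm : m ≠ 0 := by
      rintro rfl
      exact hwm (dvd_zero w)
    have := hR.card_le_one_of_mul_eq_zero hm h0
    left
    interval_cases k
    · exact ⟨0, rfl⟩
    · exact ⟨1, rfl⟩
  by_cases hsq : ∃ x : ℕ, k = x ^ 2
  · exact Or.inl hsq
  have : NeZero (m * n) := ⟨h0⟩
  obtain ⟨f, hf⟩ := hf
  obtain ⟨-, s, hs⟩ := ht
  -- the multiplier condition descends to every divisor of `w`
  have hmult (v : ℕ) (hv : v ∣ w) : ∃ s : ZMod v,
      (reductions (hv.trans hw) R).map (fun x => (t : ZMod v) * x) =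
        (reductions (hv.trans hw) R).map fun x => x + s := by
    refine ⟨ZMod.castHom hv (ZMod v) s, ?_⟩
    have := congrArg (Multiset.map (ZMod.castHom hv (ZMod v))) hs
    rw [← map_reductions hw hv]
    simpa only [reductions, Multiset.map_map, Function.comp_def, map_mul,
      map_add, map_intCast] using this
  have hpow (v : ℕ) (hv : v ∣ w) : (t : ZMod v) ^ f = -1 := by
    have := (ZMod.intCast_eq_intCast_iff _ _ v).mpr (hf.of_dvd (Int.natCast_dvd_natCast.mpr hv))
    simpa using this
  have hneg (v : ℕ) (hv : v ∣ w) : ∃ s : ZMod v,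
      (reductions (hv.trans hw) R).map (fun x => -x) =
        (reductions (hv.trans hw) R).map fun x => x + s :=
    (hmult v hv).elim fun _ h => exists_map_neg_eq_map_add h (hpow v hv)
  have hpp (p α : ℕ) (hp : p.Prime) (hpw : p ^ α ∣ w) (hpm : ¬ p ^ α ∣ m) :
      ∃ x, k = x ^ 2 * p := by
    have : NeZero (p ^ α) := ⟨pow_ne_zero _ hp.ne_zero⟩
    obtain ⟨s', hs'⟩ := hneg _ hpw
    have hnorm := hR.charSum_mul_charSum_neg (hpw.trans hw) (a := 1)
      (by rwa [one_mul, Ne, ZMod.natCast_eq_zero_iff])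
    rw [charSum_neg_eq hs', one_mul] at hnorm
    have hroot : (ZMod.stdAddChar s' : ℂ) * ZMod.stdAddChar (-s') = 1 := by
      rw [← AddChar.map_add_eq_mul]; simp
    refine (eq_sq_or_eq_sq_mul_prime (w := p ^ α) (s := -s')
      (fun r hr hrp => ((Nat.coprime_primes hr hp).mpr hrp).pow_right α) k
      (charSum_mem_cyclotomicSubring (reductions (hpw.trans hw) R) 1) ?_).resolve_left hsq
    linear_combination ZMod.stdAddChar (-s') * hnorm -
      charSum (reductions (hpw.trans hw) R) 1 ^ 2 * hroot
  obtain ⟨q, α, hq, hqw, hqm⟩ : ∃ q α : ℕ, q.Prime ∧ q ^ α ∣ w ∧ ¬ q ^ α ∣ m := by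
    by_contra! h
    exact hwm ((Nat.dvd_iff_prime_pow_dvd_dvd _ _).mpr h)
  have : Fact q.Prime := ⟨hq⟩
  have hα : α ≠ 0 := by
    rintro rfl
    simp at hqm
  have hqw' : q ∣ w := (dvd_pow_self q hα).trans hqw
  obtain ⟨k₁, hk₁⟩ := hpp q α hq hqw hqm
  have hnorm (hqm : ¬ q ∣ m) (g : ZMod q) (hg : g ≠ 0) :
      charSum (reductions (hqw'.trans hw) R) g * charSum (reductions (hqw'.trans hw) R) (-g) = k :=
    hR.charSum_mul_charSum_neg (hqw'.trans hw)
      (mul_ne_zero hg (by rwa [Ne, ZMod.natCast_eq_zero_iff]))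
  obtain ⟨s₁, hs₁⟩ := hmult q hqw'
  obtain ⟨s₂, hs₂⟩ := hneg q hqw'
  have hres (hqm : ¬ q ∣ m) (hq2 : q ≠ 2) : IsSquare (t : ZMod q) := by
    have ht0 : (t : ZMod q) ≠ 0 := by
      intro h
      have h1 := hpow q hqw'
      rw [h] at h1
      rcases eq_or_ne f 0 with rfl | hf0
      · have h2 : ((2 : ℕ) : ZMod q) = 0 := by
          push_cast
          linear_combination h1
        exact hq2 ((Nat.prime_dvd_prime_iff_eq hq Nat.prime_two).mp
          ((ZMod.natCast_eq_zero_iff 2 q).mp h2))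
      · rw [zero_pow hf0, zero_eq_neg] at h1
        exact one_ne_zero h1
    exact isSquare_of_multiplier hq2 ht0 hs₁ hs₂ (hnorm hqm) hsq
  refine Or.inr ⟨k₁, q, hq, hqw', hk₁, fun p β hp hpq hpw _ => ?_, fun hodd hqm => ?_, ?_,
    fun hqm => ?_⟩
  · by_contra hpm
    obtain ⟨y, hy⟩ := hpp p β hp hpw hpm
    have hk₁0 : k₁ ≠ 0 := by
      rintro rfl
      exact hsq ⟨0, by simpa using hk₁⟩
    exact hpq (hq.eq_of_sq_mul_eq_sq_mul hp hk₁0 (hk₁.symm.trans hy)).symm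
  · have hq2 : q ≠ 2 := by
      rintro rfl
      exact absurd hodd (by decide)
    have h1 : IsSquare (-1 : ZMod q) := by
      rw [← hpow q hqw']
      exact (hres hqm hq2).pow f
    have h3 := ZMod.exists_sq_eq_neg_one_iff.mp h1
    rw [Nat.odd_iff] at hodd
    omega
  · rintro rfl
    rcases Nat.lt_or_ge α 2 with h | h
    · obtain rfl : α = 1 := by omega
      rw [pow_one] at hqm
      refine absurd (exists_eq_sq_of_charSum_eq
        (M := reductions (hqw'.trans hw) R) (fun b hb => ?_) ?_) hsq
      · fin_cases b
        · exact absurd rfl hb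
        · rfl
      · rw [← hnorm hqm 1 one_ne_zero, sq]
        rfl
    · exact (pow_dvd_pow 2 h).trans hqw
  · rcases eq_or_ne q 2 with rfl | hq2
    · exact FiniteField.isSquare_of_char_two (ZMod.ringChar_zmod_n 2) _
    · exact hres hqm hq2
end

section
/- Let m be a prime power and let d be a divisor of m−1. Then there exists a cyclic (m+1, (m−1)/d, m, d)-relative difference set; that is, the trivial (m+1, m, m−1)-difference set (the complement of a single point) admits a lifting to a relative difference set with forbidden subgroup of order (m−1)/d. -/
/-- A cyclic `(m,n,k,l)`-relative difference set exists: an RDS in `ZMod (m*n)` relative to its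
unique subgroup of order `n`, the subgroup of multiples of `m`. -/
def IsCyclicAddRDS (m n k l : ℕ) : Prop :=
  ∃ R : Set (ZMod (m * n)),
    IsAddRDS m n k l (AddSubgroup.zmultiples ((m : ZMod (m * n)))) R

/-- The differences of a set have fibres of constant size under a surjective homomorphism which is
injective on the set. -/
lemma ncard_sub_eq_image {A B : Type*} [AddCommGroup A] [AddCommGroup B] [Finite A]
    (f : A →+ B) (hf : Function.Surjective f) {R : Set A} (hinj : Set.InjOn f R) {c : ℕ} (b : B)
    (hc : ∀ a, f a = b → {p : A × A | p.1 ∈ R ∧ p.2 ∈ R ∧ p.1 - p.2 = a}.ncard = c) :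
    {p : B × B | p.1 ∈ f '' R ∧ p.2 ∈ f '' R ∧ p.1 - p.2 = b}.ncard = c * Nat.card f.ker := by
  classical
  have := Fintype.ofFinite A
  set S : Finset (A × A) := {p | p.1 ∈ R ∧ p.2 ∈ R ∧ f (p.1 - p.2) = b} with hS
  have himage : {p : B × B | p.1 ∈ f '' R ∧ p.2 ∈ f '' R ∧ p.1 - p.2 = b} =
      Prod.map f f '' (S : Set (A × A)) := by
    ext ⟨u, v⟩
    simp only [hS, Set.mem_ofPred_eq, Set.mem_image, Finset.coe_filter, Finset.mem_univ, true_and,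
      Prod.exists, Prod.map_apply, Prod.mk.injEq, map_sub]
    constructor
    · rintro ⟨⟨x, hx, rfl⟩, ⟨y, hy, rfl⟩, h⟩
      exact ⟨x, y, ⟨hx, hy, h⟩, rfl, rfl⟩
    · rintro ⟨x, y, ⟨hx, hy, h⟩, rfl, rfl⟩
      exact ⟨⟨x, hx, rfl⟩, ⟨y, hy, rfl⟩, h⟩
  have hinjS : Set.InjOn (Prod.map f f) (S : Set (A × A)) := by
    rintro ⟨x, y⟩ hxy ⟨x', y'⟩ hxy' h
    simp only [hS, Finset.coe_filter, Finset.mem_univ, true_and, Set.mem_ofPred_eq] at hxy hxy'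
    simp only [Prod.map_apply, Prod.mk.injEq] at h
    exact Prod.ext (hinj hxy.1 hxy'.1 h.1) (hinj hxy.2.1 hxy'.2.1 h.2)
  have hfib : ∀ a ∈ ({a | f a = b} : Finset A), ({p ∈ S | p.1 - p.2 = a} : Finset _).card = c := by
    intro a ha
    rw [Finset.mem_filter_univ] at ha
    rw [← hc a ha, ← Set.ncard_coe_finset]
    congr 1
    ext p
    simp only [hS, Finset.coe_filter, Finset.mem_filter, Finset.mem_univ, true_and,
      Set.mem_ofPred_eq]
    grind
  have hker : ({a | f a = b} : Finset A).card = Nat.card f.ker := by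
    rw [AddMonoidHom.card_fiber_eq_of_mem_range f (hf b) (hf 0), Nat.card_eq_fintype_card, Fintype.card_subtype]
    simp only [AddMonoidHom.mem_ker]
  rw [himage, hinjS.ncard_image, Set.ncard_coe_finset,
    Finset.card_eq_sum_card_fiberwise (f := fun p ↦ p.1 - p.2) (t := {a | f a = b}),
    Finset.sum_congr rfl hfib, Finset.sum_const, hker, smul_eq_mul, mul_comm]
  intro p hp
  simp only [hS, Finset.coe_filter, Finset.mem_univ, true_and, Set.mem_ofPred_eq] at hp ⊢
  exact hp.2.2

/-- The image of a relative difference set modulo a subgroup of the forbidden subgroup is again a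
relative difference set. -/
lemma IsAddRDS.map {A B : Type*} [AddCommGroup A] [AddCommGroup B] [Finite A]
    {m n k l : ℕ} {N : AddSubgroup A} {R : Set A} (h : IsAddRDS m n k l N R)
    (f : A →+ B) (hf : Function.Surjective f) (hker : f.ker ≤ N) :
    IsAddRDS m (n / Nat.card f.ker) k (l * Nat.card f.ker) (N.map f) (f '' R) := by
  obtain ⟨hA, hN, hk, hl, hz⟩ := h
  have hinj : Set.InjOn f R := by
    intro x hx y hy hxy
    by_contra hne
    have hmem : x - y ∈ N := hker (by rw [AddMonoidHom.mem_ker, map_sub, hxy, sub_self])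
    have := hz _ hmem (sub_ne_zero.2 hne)
    rw [Set.ncard_eq_zero] at this
    exact this.subset (show (x, y) ∈ _ from ⟨hx, hy, rfl⟩)
  have hcard : Nat.card f.ker * Nat.card B = Nat.card A := by
    rw [← f.ker.card_mul_index, AddSubgroup.index_ker, AddMonoidHom.range_eq_top.2 hf,
      AddSubgroup.card_top]
  have hpos : 0 < Nat.card f.ker := Nat.card_pos
  have hdvd : Nat.card f.ker ∣ n := hN ▸ AddSubgroup.card_dvd_of_le hker
  have hpre : ∀ a, f a ∈ N.map f ↔ a ∈ N := by
    intro a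
    rw [← AddSubgroup.mem_comap, AddSubgroup.comap_map_eq, sup_eq_left.2 hker]
  refine ⟨?_, ?_, ?_, ?_, ?_⟩
  · rw [← Nat.mul_div_assoc _ hdvd, ← hA, ← hcard, Nat.mul_div_cancel_left _ hpos]
  · have := (f.addSubgroupMap N).ker.card_mul_index
    rw [AddSubgroup.index_ker, AddMonoidHom.range_eq_top.2 (f.addSubgroupMap_surjective N),
      AddSubgroup.card_top, hN, AddSubgroup.ker_addSubgroupMap,
      Nat.card_congr (AddSubgroup.addSubgroupOfEquivOfLe hker).toEquiv] at this
    rw [← this, Nat.mul_div_cancel_left _ hpos]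
  · rw [hinj.ncard_image, hk]
  · intro b hb
    refine ncard_sub_eq_image f hf hinj b fun a ha ↦ hl a ?_
    rwa [← hpre, ha]
  · intro b hb hb0
    rw [ncard_sub_eq_image f hf hinj (c := 0) b fun a ha ↦ hz a ?_ ?_, zero_mul]
    · rwa [← hpre, ha]
    · rintro rfl
      exact hb0 (by rw [← ha, map_zero])

section QuadraticExtension

variable {K : Type*} [Field K] [Finite K] {q : ℕ} (σ : K →+* K)

/-- In a field with `q ^ 2` elements there are `q` elements satisfying `x + x ^ q = 1`. -/
lemma ncard_add_pow_eq_one (hq : 1 < q) (hK : Nat.card K = q ^ 2) (hσ : ∀ x, σ x = x ^ q) :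
    {x : K | x + σ x = 1}.ncard = q := by
  classical
  have hneg : (-1 : K) ∈ Polynomial.nthRootsFinset (q + 1) (1 : K) := by
    rw [Polynomial.mem_nthRootsFinset (by omega), pow_succ, ← hσ, map_neg, map_one]
    ring
  have hunits : Nat.card Kˣ = (q - 1) * (q + 1) := by
    rw [Nat.card_units, hK]
    obtain ⟨r, rfl⟩ : ∃ r, q = r + 1 := ⟨q - 1, by omega⟩
    simp only [Nat.add_sub_cancel]
    rw [Nat.sub_eq_iff_eq_add (Nat.one_le_pow _ _ (by omega))]
    ring
  obtain ⟨γ, hγ⟩ := IsCyclic.exists_ofOrder_eq_natCard (α := Kˣ)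
  have hprim : IsPrimitiveRoot ((γ ^ (q - 1) : Kˣ) : K) (q + 1) :=
    IsPrimitiveRoot.coe_units_iff.2 <|
      (IsPrimitiveRoot.orderOf γ).pow (orderOf_pos γ) (hγ.trans hunits)
  have himage : {x : K | x + σ x = 1} =
      (fun u ↦ (1 + u)⁻¹) '' ((Polynomial.nthRootsFinset (q + 1) (1 : K)).erase (-1) : Set K) := by
    ext x
    simp only [Set.mem_ofPred_eq, Set.mem_image, Finset.coe_erase, Set.mem_sdiff, Finset.mem_coe,
      Set.mem_singleton_iff, Polynomial.mem_nthRootsFinset (Nat.succ_pos q)]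
    constructor
    · intro hx
      have hx0 : x ≠ 0 := by
        rintro rfl
        simp at hx
      refine ⟨σ x / x, ⟨?_, ?_⟩, ?_⟩
      · have h1 : σ x ≠ 0 := by simpa using hx0
        have h2 : σ (σ x) = x := by
          have := congrArg σ hx
          rw [map_add, map_one] at this
          linear_combination this - hx
        rw [pow_succ, ← hσ, map_div₀, h2]
        field_simp
      · intro h
        rw [div_eq_iff hx0] at h
        rw [h] at hx
        simp at hx
      · rw [one_add_div hx0, hx, one_div, inv_inv]
    · rintro ⟨u, ⟨hu, hne⟩, rfl⟩
      have h1 : 1 + u ≠ 0 := fun h ↦ hne (by linear_combination h)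
      rw [pow_succ, ← hσ] at hu
      have h2 : σ (1 + u) ≠ 0 := (map_ne_zero σ).2 h1
      rw [map_inv₀]
      rw [map_add, map_one] at h2 ⊢
      field_simp
      linear_combination -hu
  have hinj : Function.Injective (fun u : K ↦ (1 + u)⁻¹) := fun u v h ↦
    add_left_cancel (inv_injective h)
  rw [himage, Set.ncard_image_of_injective _ hinj, Set.ncard_coe_finset,
    Finset.card_erase_of_mem hneg, hprim.card_nthRootsFinset, Nat.add_sub_cancel]

/-- The elements of trace one in a field with `q ^ 2` elements form a relative difference set in
the multiplicative group, relative to the multiplicative group of the subfield of order `q`. -/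
lemma isAddRDS_add_pow_eq_one (hq : 1 < q) (hK : Nat.card K = q ^ 2) (hσ : ∀ x, σ x = x ^ q) :
    IsAddRDS (q + 1) (q - 1) q 1 (nsmulAddMonoidHom (q - 1) : Additive Kˣ →+ Additive Kˣ).ker
      {x : Additive Kˣ | (x.toMul : K) + σ x.toMul = 1} := by
  have hunits : Nat.card (Additive Kˣ) = (q + 1) * (q - 1) := by
    rw [Nat.card_congr Additive.toMul, Nat.card_units, hK]
    simpa using Nat.sq_sub_sq q 1
  have hσσ : ∀ x, σ (σ x) = x := by
    intro x
    have := Fintype.ofFinite K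
    rw [hσ, hσ, ← pow_mul, ← sq, ← hK, Nat.card_eq_fintype_card, FiniteField.pow_card]
  have hN : ∀ g : Additive Kˣ, g ∈ (nsmulAddMonoidHom (q - 1) : Additive Kˣ →+ Additive Kˣ).ker ↔
      σ g.toMul = g.toMul := by
    intro g
    have h0 : (g.toMul : K) ≠ 0 := g.toMul.ne_zero
    rw [AddMonoidHom.mem_ker, nsmulAddMonoidHom_apply, ← toMul_eq_one, toMul_nsmul, Units.ext_iff,
      Units.val_pow_eq_pow_val, Units.val_one, hσ]
    conv_rhs => rw [show q = q - 1 + 1 by omega, pow_succ]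
    exact (mul_eq_right₀ h0).symm
  refine ⟨hunits, ?_, ?_, ?_, ?_⟩
  · rw [IsAddCyclic.card_nsmulAddMonoidHom_ker, hunits, Nat.gcd_eq_right (Dvd.intro_left _ rfl)]
  · rw [← ncard_add_pow_eq_one σ hq hK hσ]
    refine Set.ncard_congr (fun x _ ↦ (x.toMul : K)) (fun _ h ↦ h) ?_ ?_
    · intro x y _ _ h
      exact Additive.toMul.injective (Units.ext h)
    · intro x hx
      have hx0 : x ≠ 0 := by
        rintro rfl
        simp at hx
      exact ⟨Additive.ofMul (Units.mk0 x hx0), hx, rfl⟩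
  · intro g hg
    rw [hN] at hg
    generalize hgu : g.toMul = u at hg
    have hsub : (u : K) - σ u ≠ 0 := fun h ↦ hg (sub_eq_zero.1 h).symm
    have hone : 1 - σ u ≠ 0 := by
      intro h
      have h1 : σ u = 1 := (sub_eq_zero.1 h).symm
      have h2 := hσσ u
      rw [h1, map_one] at h2
      exact hg (h1.trans h2)
    obtain ⟨y, hyv⟩ : ∃ y : Kˣ, (y : K) = (1 - σ u) / (u - σ u) :=
      ⟨Units.mk0 _ (div_ne_zero hone hsub), rfl⟩
    have hσy : σ y = (u - 1) / (u - σ u) := by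
      rw [hyv, map_div₀, map_sub, map_sub, map_one, hσσ, ← neg_div_neg_eq, neg_sub, neg_sub]
    rw [Set.ncard_eq_one]
    refine ⟨(Additive.ofMul (u * y), Additive.ofMul y), Set.eq_singleton_iff_unique_mem.2 ⟨?_, ?_⟩⟩
    · refine ⟨?_, ?_, ?_⟩
      · simp only [Set.mem_ofPred_eq, toMul_ofMul, Units.val_mul, map_mul, hσy]
        rw [hyv]
        field_simp
        ring
      · simp only [Set.mem_ofPred_eq, toMul_ofMul, hσy]
        rw [hyv]
        field_simp
        ring
      · rw [ofMul_mul, add_sub_cancel_right, ← hgu, ofMul_toMul]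
    · rintro ⟨a, b⟩ ⟨ha, hb, hab⟩
      simp only [Set.mem_ofPred_eq] at ha hb hab
      rw [sub_eq_iff_eq_add] at hab
      subst hab
      rw [toMul_add, hgu, Units.val_mul, map_mul] at ha
      have hb' : b.toMul = y := by
        apply Units.ext
        rw [hyv, eq_div_iff hsub]
        linear_combination ha - σ u * hb
      rw [← hb', ofMul_mul, ← hgu]
      rfl
  · intro g hg hg0
    rw [hN] at hg
    rw [Set.ncard_eq_zero, Set.eq_empty_iff_forall_notMem]
    rintro ⟨a, b⟩ ⟨ha, hb, hab⟩
    simp only [Set.mem_ofPred_eq] at ha hb hab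
    rw [sub_eq_iff_eq_add] at hab
    subst hab
    rw [toMul_add, Units.val_mul, map_mul, hg, ← mul_add, hb, mul_one] at ha
    exact hg0 (toMul_eq_one.1 (Units.ext ha))

end QuadraticExtension

/-- In a finite cyclic group, a subgroup is determined by its order. -/
lemma AddSubgroup.eq_of_card_eq_of_isAddCyclic {G : Type*} [AddCommGroup G] [IsAddCyclic G]
    [Finite G] {H H' : AddSubgroup G} (h : Nat.card H = Nat.card H') : H = H' := by
  have key : ∀ L : AddSubgroup G, L = (nsmulAddMonoidHom (Nat.card L) : G →+ G).ker := by
    intro L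
    refine AddSubgroup.eq_of_le_of_card_ge (fun x hx ↦ ?_) ?_
    · rw [AddMonoidHom.mem_ker, nsmulAddMonoidHom_apply]
      exact addOrderOf_dvd_iff_nsmul_eq_zero.1 (L.addOrderOf_dvd_natCard hx)
    · rw [IsAddCyclic.card_nsmulAddMonoidHom_ker, Nat.gcd_eq_right L.card_addSubgroup_dvd_card]
  rw [key H, key H', h]

/-- Lifting of the trivial `(m+1, m, m-1)`-difference set: for `m` a prime power and `d` a
divisor of `m-1`, a cyclic `(m+1, (m-1)/d, m, d)`-relative difference set exists. -/
theorem trivial_ds_lift (m d : ℕ) (hm : IsPrimePow m) (hd : d ∣ m - 1) :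
    IsCyclicAddRDS (m + 1) ((m - 1) / d) m d := by
  have hm1 := hm.one_lt
  obtain ⟨p, r, hp, hr, hpr⟩ := (isPrimePow_nat_iff _).1 hm
  have := Fact.mk hp
  let K := GaloisField p (r * 2)
  have : Finite K := inferInstanceAs (Finite (GaloisField p (r * 2)))
  have hK : Nat.card K = m ^ 2 := by
    rw [GaloisField.card p _ (by omega), pow_mul, hpr]
  have hRDS := isAddRDS_add_pow_eq_one (iterateFrobenius K p r) hm1 hK fun x ↦ by
    rw [iterateFrobenius_def, hpr]
  obtain ⟨n, hn⟩ := hd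
  have hd0 : 0 < d := Nat.pos_of_ne_zero (by rintro rfl; omega)
  have hn0 : 0 < n := Nat.pos_of_ne_zero (by rintro rfl; omega)
  have hnd : (m - 1) / d = n := by rw [hn, Nat.mul_div_cancel_left _ hd0]
  have hcard := hRDS.1
  rw [hnd]
  have : NeZero ((m + 1) * n) := ⟨by positivity⟩
  have hdvd : (m + 1) * n ∣ Nat.card (Additive Kˣ) := by
    rw [hcard, hn]
    exact mul_dvd_mul_left _ (Dvd.intro_left _ rfl)
  let f : Additive Kˣ →+ ZMod ((m + 1) * n) :=
    (ZMod.castHom hdvd (ZMod ((m + 1) * n))).toAddMonoidHom.comp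
      (zmodAddCyclicAddEquiv (G := Additive Kˣ) inferInstance).symm.toAddMonoidHom
  have hf : Function.Surjective f :=
    (ZMod.castHom_surjective hdvd).comp (zmodAddCyclicAddEquiv _).symm.surjective
  have hkercard : Nat.card f.ker = d := by
    have h := f.ker.card_mul_index
    rw [AddSubgroup.index_ker, AddMonoidHom.range_eq_top.2 hf, AddSubgroup.card_top,
      Nat.card_zmod, hcard, hn] at h
    refine Nat.eq_of_mul_eq_mul_right (Nat.pos_of_neZero ((m + 1) * n)) ?_
    rw [h]
    ring
  have hker : f.ker ≤ (nsmulAddMonoidHom (m - 1) : Additive Kˣ →+ Additive Kˣ).ker := by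
    intro x hx
    rw [AddMonoidHom.mem_ker, nsmulAddMonoidHom_apply, ← addOrderOf_dvd_iff_nsmul_eq_zero]
    exact (hkercard ▸ f.ker.addOrderOf_dvd_natCard hx).trans (Dvd.intro _ hn.symm)
  have h := hRDS.map f hf hker
  rw [hkercard, hnd, one_mul] at h
  refine ⟨_, (?_ : AddSubgroup.map f _ = _) ▸ h⟩
  refine AddSubgroup.eq_of_card_eq_of_isAddCyclic ?_
  rw [h.2.1, Nat.card_zmultiples, ZMod.addOrderOf_coe _ (NeZero.ne _),
    Nat.gcd_eq_right (Dvd.intro _ rfl), Nat.mul_div_cancel_left _ (by omega)]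
end

section
/- If a circulant weighing matrix CW(n,k) exists with k ≥ 1, then k is a perfect square. -/
/-- `w` is a circulant weighing matrix `CW(n,k)`: entries in `{-1,0,1}` and all nontrivial
autocorrelations vanish, while the trivial one equals `k`. -/
def IsCW (n k : ℕ) (w : ZMod n → ℤ) : Prop :=
  (∀ i : ZMod n, w i = -1 ∨ w i = 0 ∨ w i = 1) ∧
    ∀ t : ZMod n,
      (∑ i ∈ Finset.range n, w (i : ZMod n) * w ((i : ZMod n) + t)) =
        if t = 0 then (k : ℤ) else 0

theorem ZMod.sum_range_natCast {M : Type*} [AddCommMonoid M] (n : ℕ) [NeZero n] (f : ZMod n → M) :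
    ∑ i ∈ Finset.range n, f (i : ZMod n) = ∑ i : ZMod n, f i :=
  Finset.sum_nbij' (fun i : ℕ => (i : ZMod n)) ZMod.val (by simp)
    (fun i _ => Finset.mem_range.2 (ZMod.val_lt i))
    (fun _ hi => ZMod.val_cast_of_lt (Finset.mem_range.1 hi))
    (fun i _ => ZMod.natCast_zmod_val i) (by simp)

/-- The weight of a circulant weighing matrix is a perfect square. -/
theorem cw_weight_is_square (n k : ℕ) (hk : 1 ≤ k) (w : ZMod n → ℤ) (hw : IsCW n k w) :
    ∃ x : ℕ, k = x ^ 2 := by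
  obtain ⟨-, h⟩ := hw
  rcases Nat.eq_zero_or_pos n with rfl | hn
  · have h0 := h 0
    simp at h0
    omega
  · have : NeZero n := ⟨hn.ne'⟩
    have key : (∑ i, w i) * (∑ i, w i) = (k : ℤ) := by
      calc (∑ i, w i) * (∑ i, w i) = ∑ i, ∑ t, w i * w (i + t) := by
            rw [Finset.sum_mul]
            refine Finset.sum_congr rfl fun i _ => ?_
            rw [← Finset.mul_sum, ← Equiv.sum_comp (Equiv.addLeft i) w]
            rfl
        _ = ∑ t : ZMod n, if t = 0 then (k : ℤ) else 0 := by
            rw [Finset.sum_comm]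
            refine Finset.sum_congr rfl fun t _ => ?_
            rw [← h t, ZMod.sum_range_natCast n fun i => w i * w (i + t)]
        _ = k := by simp
    refine ⟨(∑ i, w i).natAbs, ?_⟩
    zify
    rw [sq_abs, sq, key]
end
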